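/- If F=(W,R,P) is a rooted finitely generated descriptive frame for K4.3, then W is countable. -/

import Mathlib

/-! ## Modal formulas -/

inductive MF : Type
  | var : ℕ → MF
  | top : MF
  | bot : MF
  | neg : MF → MF
  | and : MF → MF → MF
  | dia : MF → MF
deriving DecidableEq

namespace MF

def or (φ ψ : MF) : MF := .neg (.and (.neg φ) (.neg ψ))
def imp (φ ψ : MF) : MF := MF.or (.neg φ) ψ
def box (φ : MF) : MF := .neg (.dia (.neg φ))
def diaPlus (φ : MF) : MF := MF.or φ (.dia φ)
def boxPlus (φ : MF) : MF := .and φ (box φ)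

/-- the propositional variables occurring in a formula -/
def vars : MF → Finset ℕ
  | .var p => {p}
  | .top => ∅
  | .bot => ∅
  | .neg φ => vars φ
  | .and φ ψ => vars φ ∪ vars ψ
  | .dia φ => vars φ

/-- the signature of a formula -/
def sig (φ : MF) : Set ℕ := ↑(vars φ)

/-- subformulas -/
def subs : MF → Finset MF
  | .var p => {.var p}
  | .top => {.top}
  | .bot => {.bot}
  | .neg φ => insert (.neg φ) (subs φ)
  | .and φ ψ => insert (.and φ ψ) (subs φ ∪ subs ψ)
  | .dia φ => insert (.dia φ) (subs φ)

/-- `|φ|`: the number of subformulas of `φ` together with their negations -/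
def size (φ : MF) : ℕ := ((subs φ) ∪ (subs φ).image MF.neg).card

/-- uniform substitution -/
def substVar (s : ℕ → MF) : MF → MF
  | .var p => s p
  | .top => .top
  | .bot => .bot
  | .neg φ => .neg (substVar s φ)
  | .and φ ψ => .and (substVar s φ) (substVar s ψ)
  | .dia φ => .dia (substVar s φ)

end MF

/-- a Boolean evaluation of modal formulas (treating `◇`-formulas and variables as atoms) -/
def BoolEval (f : MF → Prop) : Prop :=
  f .top ∧ ¬ f .bot ∧ (∀ φ, f (.neg φ) ↔ ¬ f φ) ∧ (∀ φ ψ, f (.and φ ψ) ↔ (f φ ∧ f ψ))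

/-- Boolean tautologies in the modal language -/
def MF.Tautology (φ : MF) : Prop := ∀ f : MF → Prop, BoolEval f → f φ

/-- normal modal logics -/
structure IsNormalLogic (L : Set MF) : Prop where
  taut : ∀ φ, φ.Tautology → φ ∈ L
  axK : MF.imp (MF.box (MF.imp (.var 0) (.var 1)))
          (MF.imp (MF.box (.var 0)) (MF.box (.var 1))) ∈ L
  mp : ∀ φ ψ, φ ∈ L → MF.imp φ ψ ∈ L → ψ ∈ L
  subst : ∀ φ s, φ ∈ L → MF.substVar s φ ∈ L
  nec : ∀ φ, φ ∈ L → MF.box φ ∈ L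

/-- the smallest normal modal logic containing `Γ` -/
def NormClosure (Γ : Set MF) : Set MF :=
  {φ | ∀ L : Set MF, IsNormalLogic L → Γ ⊆ L → φ ∈ L}

def ax4 : MF := MF.imp (MF.box (.var 0)) (MF.box (MF.box (.var 0)))
def ax43 : MF := MF.or (MF.box (MF.imp (MF.boxPlus (.var 0)) (.var 1)))
                       (MF.box (MF.imp (MF.boxPlus (.var 1)) (.var 0)))
def axGL : MF := MF.imp (MF.box (MF.imp (MF.box (.var 0)) (.var 0))) (MF.box (.var 0))

def K4 : Set MF := NormClosure {ax4}
def K43 : Set MF := NormClosure {ax4, ax43}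
def GL3 : Set MF := NormClosure {ax4, ax43, axGL}

/-! ## General frames and models -/

/-- a (general) frame: a relation together with a collection of "internal" sets -/
structure KFrame (W : Type) where
  R : W → W → Prop
  P : Set (Set W)

namespace KFrame

variable {W : Type}

def dia (F : KFrame W) (X : Set W) : Set W := {x | ∃ y ∈ X, F.R x y}

/-- the conditions making `F` a general frame -/
def IsGeneral (F : KFrame W) : Prop :=
  Nonempty W ∧ ∅ ∈ F.P ∧ Set.univ ∈ F.P ∧
    (∀ X ∈ F.P, ∀ Y ∈ F.P, X ∩ Y ∈ F.P) ∧
    (∀ X ∈ F.P, Xᶜ ∈ F.P) ∧ (∀ X ∈ F.P, F.dia X ∈ F.P)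

/-- differentiated, tight and compact -/
def Descriptive (F : KFrame W) : Prop :=
  (∀ x y : W, (∀ X ∈ F.P, x ∈ X ↔ y ∈ X) → x = y) ∧
  (∀ x y : W, F.R x y ↔ ∀ X ∈ F.P, y ∈ X → x ∈ F.dia X) ∧
  (∀ 𝒳 : Set (Set W), 𝒳 ⊆ F.P →
    (∀ 𝒴 : Set (Set W), 𝒴 ⊆ 𝒳 → 𝒴.Finite → (⋂₀ 𝒴).Nonempty) → (⋂₀ 𝒳).Nonempty)

/-- `x` is a root of `F` (every point is reachable from `x` via the reflexive closure) -/
def Rooted (F : KFrame W) (x : W) : Prop := ∀ y : W, x = y ∨ F.R x y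

/-- the strict order on clusters: `C(x) <_R C(y)` -/
def clLT (F : KFrame W) (x y : W) : Prop := F.R x y ∧ ¬ F.R y x

/-- the cluster of a point -/
def cluster (F : KFrame W) (x : W) : Set W := insert x {y | F.R x y ∧ F.R y x}

def clLE (F : KFrame W) (x y : W) : Prop := y ∈ F.cluster x ∨ F.clLT x y

/-- the closed interval of clusters `[C(x), C(y)]` -/
def interval (F : KFrame W) (x y : W) : Set W := {z | F.clLE x z ∧ F.clLE z y}

/-- `C(x)` is the final cluster -/
def FinalCl (F : KFrame W) (x : W) : Prop := ∀ y, ¬ F.clLT x y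

/-- `C(y)` is an immediate successor of `C(x)` -/
def ImmSucc (F : KFrame W) (x y : W) : Prop :=
  F.clLT x y ∧ ¬ ∃ z, F.clLT x z ∧ F.clLT z y

/-- `C(x)` is a limit cluster -/
def LimitCl (F : KFrame W) (x : W) : Prop := ¬ F.FinalCl x ∧ ¬ ∃ y, F.ImmSucc x y

/-- `C(x)` is a degenerate cluster -/
def DegenerateCl (F : KFrame W) (x : W) : Prop := ¬ F.R x x

end KFrame

/-- the closure of a family of sets under `∩`, complement and `◇` -/
inductive genBy {W : Type} (R : W → W → Prop) (G : Set (Set W)) : Set W → Prop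
  | basic {X : Set W} : X ∈ G → genBy R G X
  | empty : genBy R G ∅
  | univ : genBy R G Set.univ
  | inter {X Y : Set W} : genBy R G X → genBy R G Y → genBy R G (X ∩ Y)
  | compl {X : Set W} : genBy R G X → genBy R G Xᶜ
  | dia {X : Set W} : genBy R G X → genBy R G {x | ∃ y ∈ X, R x y}

def KFrame.GeneratedBy {W : Type} (F : KFrame W) (G : Set (Set W)) : Prop :=
  F.P = {X | genBy F.R G X}

def KFrame.FinGenerated {W : Type} (F : KFrame W) : Prop :=
  ∃ G : Set (Set W), G.Finite ∧ F.GeneratedBy G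

def KFrame.NGenerated {W : Type} (F : KFrame W) (n : ℕ) : Prop :=
  ∃ G : Set (Set W), G.Finite ∧ G.ncard = n ∧ F.GeneratedBy G

/-- a model: a frame with a valuation -/
structure KModel (W : Type) where
  F : KFrame W
  v : ℕ → Set W

namespace KModel

variable {W : Type}

/-- the frame is a general frame and all values of the valuation are internal -/
def IsModel (M : KModel W) : Prop := M.F.IsGeneral ∧ ∀ p, M.v p ∈ M.F.P

/-- truth at a point -/
def sat (M : KModel W) : W → MF → Prop
  | x, .var p => x ∈ M.v p
  | _, .top => True
  | _, .bot => False
  | x, .neg φ => ¬ sat M x φ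
  | x, .and φ ψ => sat M x φ ∧ sat M x ψ
  | x, .dia φ => ∃ y, M.F.R x y ∧ sat M y φ

/-- a set is definable in `M` -/
def Definable (M : KModel W) (X : Set W) : Prop := ∃ φ : MF, X = {x | M.sat x φ}

/-- every internal set is definable in `M` -/
def MGenerated (M : KModel W) : Prop := ∀ X ∈ M.F.P, M.Definable X

/-- finitely `M`-generated -/
def FinMGenerated (M : KModel W) : Prop := M.MGenerated ∧ M.F.FinGenerated

/-- the σ-type of a point: all σ-formulas true at it -/
def stype (M : KModel W) (σ : Set ℕ) (x : W) : Set MF := {φ | φ.sig ⊆ σ ∧ M.sat x φ}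

/-- `x` is `Γ`-maximal in `M` -/
def MaxFor (M : KModel W) (Γ : Set MF) (x : W) : Prop :=
  (∀ γ ∈ Γ, M.sat x γ) ∧ ∀ y, M.F.R x y → (∀ γ ∈ Γ, M.sat y γ) → M.F.R y x

/-- the cluster `C(x)` is `μ`-maximal in `M` -/
def ClMuMax (M : KModel W) (μ : MF) (x : W) : Prop := ∃ z ∈ M.F.cluster x, M.MaxFor {μ} z

/-- the cluster `C(x)` is maximal in `M` -/
def ClMax (M : KModel W) (x : W) : Prop := ∃ μ : MF, M.ClMuMax μ x

/-- the cluster `C(x)` is σ-maximal in `M` -/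
def ClSigMax (M : KModel W) (σ : Set ℕ) (x : W) : Prop :=
  ∃ μ : MF, μ.sig ⊆ σ ∧ M.ClMuMax μ x

/-- the cluster `C(x)` is definable in `M` -/
def ClDefinable (M : KModel W) (x : W) : Prop := M.Definable (M.F.cluster x)

/-- `◇ t^σ_M(x) ⊆ t^σ_M(y)` -/
def diaSubset (M : KModel W) (σ : Set ℕ) (x y : W) : Prop :=
  ∀ φ ∈ M.stype σ x, MF.dia φ ∈ M.stype σ y

/-- the σ-block of a point -/
def sblockOf (M : KModel W) (σ : Set ℕ) (x : W) : Set W :=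
  {y | (M.diaSubset σ x x ∧ M.diaSubset σ y x ∧ M.diaSubset σ x y) ∨
       (¬ M.diaSubset σ x x ∧ y = x)}

/-- a σ-block in `M` -/
def IsSBlock (M : KModel W) (σ : Set ℕ) (b : Set W) : Prop := ∃ x, b = M.sblockOf σ x

/-- a degenerate σ-block in `M` -/
def DegenSBlock (M : KModel W) (σ : Set ℕ) (b : Set W) : Prop :=
  ∃ x, b = M.sblockOf σ x ∧ ¬ M.diaSubset σ x x

end KModel

/-- validity of a formula on a frame -/
def KFrame.Valid {W : Type} (F : KFrame W) (φ : MF) : Prop :=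
  ∀ v : ℕ → Set W, (∀ p, v p ∈ F.P) → ∀ x, (KModel.mk F v).sat x φ

/-- `F` is a frame for the logic `L` -/
def KFrame.IsFrameFor {W : Type} (F : KFrame W) (L : Set MF) : Prop :=
  ∀ φ ∈ L, F.Valid φ

/-! ## Bisimulations -/

def IsBisim {W₁ W₂ : Type} (σ : Set ℕ) (M₁ : KModel W₁) (M₂ : KModel W₂)
    (β : W₁ → W₂ → Prop) : Prop :=
  ∀ x₁ x₂, β x₁ x₂ →
    (∀ p ∈ σ, x₁ ∈ M₁.v p ↔ x₂ ∈ M₂.v p) ∧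
    (∀ y₁, M₁.F.R x₁ y₁ → ∃ y₂, M₂.F.R x₂ y₂ ∧ β y₁ y₂) ∧
    (∀ y₂, M₂.F.R x₂ y₂ → ∃ y₁, M₁.F.R x₁ y₁ ∧ β y₁ y₂)

def Bisimilar {W₁ W₂ : Type} (σ : Set ℕ) (M₁ : KModel W₁) (x₁ : W₁)
    (M₂ : KModel W₂) (x₂ : W₂) : Prop :=
  ∃ β, IsBisim σ M₁ M₂ β ∧ β x₁ x₂

/-- the two points satisfy the same variables of `σ` -/
def SigAgree {W₁ W₂ : Type} (σ : Set ℕ) (M₁ : KModel W₁) (x₁ : W₁)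
    (M₂ : KModel W₂) (x₂ : W₂) : Prop :=
  ∀ p ∈ σ, x₁ ∈ M₁.v p ↔ x₂ ∈ M₂.v p

/-- the two points have the same σ-type -/
def TypeEquiv {W₁ W₂ : Type} (σ : Set ℕ) (M₁ : KModel W₁) (x₁ : W₁)
    (M₂ : KModel W₂) (x₂ : W₂) : Prop :=
  ∀ φ : MF, φ.sig ⊆ σ → (M₁.sat x₁ φ ↔ M₂.sat x₂ φ)

/-! ## Interpolants -/

def IsInterpolant (L : Set MF) (φ₁ φ₂ ι : MF) : Prop :=
  ι.sig ⊆ φ₁.sig ∩ φ₂.sig ∧ MF.imp φ₁ ι ∈ L ∧ MF.imp ι φ₂ ∈ L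

def NoInterpolant (L : Set MF) (φ₁ φ₂ : MF) : Prop := ¬ ∃ ι, IsInterpolant L φ₁ φ₂ ι

def HasCIP (L : Set MF) : Prop :=
  ∀ φ₁ φ₂ : MF, MF.imp φ₁ φ₂ ∈ L → ∃ ι, IsInterpolant L φ₁ φ₂ ι

/-- `k(φ₁,φ₂) = 3 + 3·max(|φ₁|,|φ₂|)` -/
def kBound (φ₁ φ₂ : MF) : ℕ := 3 + 3 * max φ₁.size φ₂.size

/-- the conjunction of a finite list of formulas -/
def conjList : List MF → MF
  | [] => .top
  | φ :: l => .and φ (conjList l)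

/-! ## d-persistence and cofinal subframe logics -/

def DPersistent (L : Set MF) : Prop :=
  ∀ (W : Type) (F : KFrame W), F.IsGeneral → F.Descriptive → F.IsFrameFor L →
    KFrame.IsFrameFor ⟨F.R, (Set.univ : Set (Set W))⟩ L

def CofinalSet {W : Type} (F : KFrame W) (S : Set W) : Prop :=
  ∀ x ∈ S, ∀ y, F.R x y → y ∈ S ∨ ∃ z ∈ S, F.R y z

/-- the subframe of `F` with underlying set `S` and internal sets `Q` -/
def subframeOn {W : Type} (F : KFrame W) (S : Set W) (Q : Set (Set W)) : KFrame S :=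
  ⟨fun a b => F.R a.1 b.1, {T | ∃ X ∈ Q, T = (Subtype.val ⁻¹' X : Set S)}⟩

/-- the class of general frames of `L` is closed under cofinal subframes -/
def CofinalSubframeLogic (L : Set MF) : Prop :=
  ∀ (W : Type) (F : KFrame W) (S : Set W) (Q : Set (Set W)),
    F.IsGeneral → F.IsFrameFor L → Q ⊆ F.P → (∀ X ∈ Q, X ⊆ S) →
    (subframeOn F S Q).IsGeneral → CofinalSet F S →
    (subframeOn F S Q).IsFrameFor L

/-- the subframe of `F` generated by a point `x` -/
def KFrame.genSub {W : Type} (F : KFrame W) (x : W) :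
    KFrame {y : W // x = y ∨ F.R x y} :=
  ⟨fun a b => F.R a.1 b.1, {S | ∃ X ∈ F.P, S = Subtype.val ⁻¹' X}⟩

namespace KFrame

variable {W : Type} {F : KFrame W}

theorem dia_mono {X Y : Set W} (h : X ⊆ Y) : F.dia X ⊆ F.dia Y :=
  fun _ ⟨y, hy, hR⟩ => ⟨y, h hy, hR⟩

theorem Descriptive.exists_of_not_rel (hd : F.Descriptive) {x y : W} (h : ¬ F.R x y) :
    ∃ X ∈ F.P, y ∈ X ∧ x ∉ F.dia X := by
  rw [hd.2.1] at h
  push Not at h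
  exact h

theorem IsGeneral.sInter_mem (hg : F.IsGeneral) {S : Set (Set W)} (hS : S.Finite)
    (hP : S ⊆ F.P) : ⋂₀ S ∈ F.P := by
  induction S, hS using Set.Finite.induction_on with
  | empty => simpa using hg.2.2.1
  | @insert X S _ _ ih =>
    rw [Set.sInter_insert]
    exact hg.2.2.2.1 _ (hP (Set.mem_insert _ _)) _
      (ih fun Y hY => hP (Set.mem_insert_of_mem _ hY))

theorem IsGeneral.iInter_mem (hg : F.IsGeneral) {ι : Type*} [Finite ι] {X : ι → Set W}
    (hX : ∀ i, X i ∈ F.P) : ⋂ i, X i ∈ F.P := by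
  rw [← Set.sInter_range]
  exact hg.sInter_mem (Set.finite_range X) (Set.range_subset_iff.2 hX)

/-- Descriptive frames for `K4.3` are transitive. -/
theorem Descriptive.transitive_of_K43 (hg : F.IsGeneral) (hd : F.Descriptive)
    (hK : F.IsFrameFor K43) {x y z : W} (hxy : F.R x y) (hyz : F.R y z) : F.R x z := by
  rw [hd.2.1]
  intro Z hZ hz
  have h := hK ax4 (fun L _ hL => hL (by simp)) (fun _ => Zᶜ) (fun _ => hg.2.2.2.2.1 _ hZ) x
  simp only [ax4, MF.imp, MF.or, MF.box, KModel.sat, Set.mem_compl_iff, not_not] at h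
  by_contra hx
  exact h ⟨fun ⟨u, hu, huZ⟩ => hx ⟨u, huZ, hu⟩, y, hxy, z, hyz, hz⟩

/-- Descriptive frames for `K4.3` are weakly connected. -/
theorem Descriptive.connected_of_K43 (hg : F.IsGeneral) (hd : F.Descriptive)
    (hK : F.IsFrameFor K43) {x y z : W} (hxy : F.R x y) (hxz : F.R x z) :
    y = z ∨ F.R y z ∨ F.R z y := by
  by_contra! hcon
  obtain ⟨hne, hyz, hzy⟩ := hcon
  obtain ⟨A, hA, hzA, hyA⟩ := hd.exists_of_not_rel hyz
  obtain ⟨B, hB, hyB, hzB⟩ := hd.exists_of_not_rel hzy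
  obtain ⟨D, hD, hyD, hzD⟩ : ∃ D ∈ F.P, y ∈ D ∧ z ∉ D := by
    have h := mt (hd.1 y z) hne
    push Not at h
    obtain ⟨D, hD, ⟨h₁, h₂⟩ | ⟨h₁, h₂⟩⟩ := h
    · exact ⟨D, hD, h₁, h₂⟩
    · exact ⟨Dᶜ, hg.2.2.2.2.1 _ hD, h₁, fun h => h h₂⟩
  have h := hK ax43 (fun L _ hL => hL (by simp))
    (fun n => if n = 0 then (A ∩ Dᶜ)ᶜ else (B ∩ D)ᶜ)
    (fun n => by
      have hDc := hg.2.2.2.2.1 _ hD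
      split_ifs
      · exact hg.2.2.2.2.1 _ (hg.2.2.2.1 _ hA _ hDc)
      · exact hg.2.2.2.2.1 _ (hg.2.2.2.1 _ hB _ hD)) x
  simp only [ax43, MF.imp, MF.or, MF.box, MF.boxPlus, KModel.sat, not_not] at h
  refine h ⟨⟨y, hxy, ⟨fun h => h.2 hyD, ?_⟩, fun h => h ⟨hyB, hyD⟩⟩,
    ⟨z, hxz, ⟨fun h => hzD h.2, ?_⟩, fun h => h ⟨hzA, hzD⟩⟩⟩
  · rintro ⟨u, hu, hu'⟩
    exact hu' fun h => hyA ⟨u, h.1, hu⟩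
  · rintro ⟨u, hu, hu'⟩
    exact hu' fun h => hzB ⟨u, h.1, hu⟩

/-- If `N` is internal and disjoint from the reflexive part of the cluster of `x`, then some
internal neighbourhood `Y` of `x` witnesses that no `R`-successor of `x` in `N` sees `Y`. -/
theorem Descriptive.exists_neighbourhood (hg : F.IsGeneral) (hd : F.Descriptive) {x : W}
    {N : Set W} (hN : N ∈ F.P) (hx : ∀ z, F.R x z → F.R z x → z ∉ N) :
    ∃ Y ∈ F.P, x ∈ Y ∧ ∀ z, F.R x z → z ∈ F.dia Y → z ∉ N := by
  by_contra! hcon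
  let 𝒳 : Set (Set W) := {Z | Z ∈ F.P ∧ ∃ Y ∈ F.P, x ∈ Y ∧
    ∀ z, F.R x z → z ∈ F.dia Y → z ∈ N → z ∈ Z}
  obtain ⟨z, hz⟩ := hd.2.2 𝒳 (fun Z hZ => hZ.1) (by
    intro 𝒴 h𝒴 hfin
    suffices h : ∃ Y ∈ F.P, x ∈ Y ∧ ∀ z, F.R x z → z ∈ F.dia Y → z ∈ N → z ∈ ⋂₀ 𝒴 by
      obtain ⟨Y, hY, hxY, h⟩ := h
      obtain ⟨z, h₁, h₂, h₃⟩ := hcon Y hY hxY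
      exact ⟨z, h z h₁ h₂ h₃⟩
    induction 𝒴, hfin using Set.Finite.induction_on with
    | empty => exact ⟨Set.univ, hg.2.2.1, trivial, by simp⟩
    | @insert Z 𝒴 _ _ ih =>
      obtain ⟨Y₁, hY₁, hx₁, h₁⟩ := ih fun Y hY => h𝒴 (Set.mem_insert_of_mem _ hY)
      obtain ⟨-, Y₂, hY₂, hx₂, h₂⟩ := h𝒴 (Set.mem_insert Z 𝒴)
      refine ⟨Y₁ ∩ Y₂, hg.2.2.2.1 _ hY₁ _ hY₂, ⟨hx₁, hx₂⟩, fun z hxz hzY hzN => ?_⟩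
      rw [Set.sInter_insert]
      exact ⟨h₂ z hxz (dia_mono Set.inter_subset_right hzY) hzN,
        h₁ z hxz (dia_mono Set.inter_subset_left hzY) hzN⟩)
  have hzN : z ∈ N := hz N ⟨hN, Set.univ, hg.2.2.1, trivial, fun _ _ _ h => h⟩
  refine hx z ?_ ?_ hzN
  · rw [hd.2.1]
    intro X hX hzX
    by_contra hxX
    exact hz Xᶜ ⟨hg.2.2.2.2.1 _ hX, Set.univ, hg.2.2.1, trivial,
      fun u hu _ _ huX => hxX ⟨u, huX, hu⟩⟩ hzX
  · rw [hd.2.1]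
    intro X hX hxX
    exact hz (F.dia X) ⟨hg.2.2.2.2.2 _ hX, X, hX, hxX, fun _ _ h _ => h⟩

/-- The members of `G` containing a point. -/
def genType (G : Set (Set W)) (x : W) : Set G := {g | x ∈ g.1}

/-- The types realised in the cluster of a point. -/
def clusterTypes (F : KFrame W) (G : Set (Set W)) (x : W) : Set (Set G) :=
  genType G '' F.cluster x

theorem IsGeneral.genType_preimage_mem (hg : F.IsGeneral) {G : Set (Set W)} (hG : G.Finite)
    (hGP : G ⊆ F.P) (A : Set (Set G)) : {z | genType G z ∈ A} ∈ F.P := by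
  have : Finite G := hG
  have hsingle : ∀ a : Set G, {z | genType G z = a} ∈ F.P := by
    intro a
    have h : ⋂ g : G, {z : W | z ∈ g.1 ↔ g ∈ a} ∈ F.P := by
      refine hg.iInter_mem fun g => ?_
      by_cases hga : g ∈ a
      · simpa [hga] using hGP g.2
      · simpa [hga, Set.compl_def] using hg.2.2.2.2.1 _ (hGP g.2)
    convert h using 1
    ext z
    simp only [Set.mem_ofPred_eq, Set.mem_iInter, Set.ext_iff, genType]
  have h : ⋂ a : ↥Aᶜ, {z | genType G z = a.1}ᶜ ∈ F.P :=
    hg.iInter_mem fun a => hg.2.2.2.2.1 _ (hsingle a)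
  convert h using 1
  ext z
  simp only [Set.mem_ofPred_eq, Set.mem_iInter, Set.mem_compl_iff]
  exact ⟨fun hz a ha => a.2 (ha ▸ hz), fun hz => by_contra fun hA => hz ⟨_, hA⟩ rfl⟩

/-- Points of an interval between reflexive points agree on all generated sets as soon as they
agree on the generators, provided that all types of the interval occur in its last cluster. -/
theorem mem_iff_mem_of_genType_eq {G : Set (Set W)} {x y : W}
    (htrans : ∀ {u v w}, F.R u v → F.R v w → F.R u w)
    (hconn : ∀ {u v w}, F.R u v → F.R u w → v = w ∨ F.R v w ∨ F.R w v)
    (hxy : F.R x y) (hy : F.R y y)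
    (hT : ∀ z, F.R x z → F.R z y → genType G z ∈ F.clusterTypes G y)
    {X : Set W} (hX : genBy F.R G X) :
    ∀ {z w}, F.R x z → F.R z y → F.R x w → F.R w y → genType G z = genType G w →
      (z ∈ X ↔ w ∈ X) := by
  induction hX with
  | @basic X hXG =>
    intro z w _ _ _ _ ht
    exact Set.ext_iff.1 ht ⟨X, hXG⟩
  | empty => simp
  | univ => simp
  | inter _ _ ih₁ ih₂ =>
    intro z w h₁ h₂ h₃ h₄ ht
    exact and_congr (ih₁ h₁ h₂ h₃ h₄ ht) (ih₂ h₁ h₂ h₃ h₄ ht)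
  | compl _ ih =>
    intro z w h₁ h₂ h₃ h₄ ht
    exact not_congr (ih h₁ h₂ h₃ h₄ ht)
  | @dia X _ ih =>
    have key : ∀ {z w}, F.R x z → F.R w y → (∃ u ∈ X, F.R z u) → ∃ u ∈ X, F.R w u := by
      rintro z w hxz hwy ⟨u, huX, hzu⟩
      have hxu := htrans hxz hzu
      by_cases huy : F.R u y
      · obtain ⟨u', hu', ht⟩ := hT u hxu huy
        have hyu' : F.R y u' ∧ F.R u' y := by
          rcases hu' with rfl | h
          · exact ⟨hy, hy⟩
          · exact h
        exact ⟨u', (ih (htrans hxy hyu'.1) hyu'.2 hxu huy ht).2 huX, htrans hwy hyu'.1⟩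
      · rcases hconn hxu hxy with rfl | h | h
        · exact ⟨u, huX, hwy⟩
        · exact absurd h huy
        · exact ⟨u, huX, htrans hwy h⟩
    intro z w h₁ h₂ h₃ h₄ _
    exact ⟨key h₁ h₄, key h₃ h₂⟩

end KFrame

/-- A stage-by-stage construction of the sets generated by `G`. -/
def genStage {W : Type} (R : W → W → Prop) (G : Set (Set W)) : ℕ → Set (Set W)
  | 0 => G ∪ {∅, Set.univ}
  | n + 1 => genStage R G n ∪ Set.image2 (· ∩ ·) (genStage R G n) (genStage R G n) ∪
      compl '' genStage R G n ∪ (fun X => {x | ∃ y ∈ X, R x y}) '' genStage R G n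

theorem genStage_countable {W : Type} (R : W → W → Prop) {G : Set (Set W)} (hG : G.Countable)
    (n : ℕ) : (genStage R G n).Countable := by
  induction n with
  | zero => exact hG.union (Set.toFinite _).countable
  | succ n ih => exact ((ih.union (ih.image2 ih _)).union (ih.image _)).union (ih.image _)

theorem genStage_mono {W : Type} (R : W → W → Prop) (G : Set (Set W)) :
    Monotone (genStage R G) :=
  monotone_nat_of_le_succ fun _ _ hX => Or.inl (Or.inl (Or.inl hX))

theorem genBy.exists_mem_genStage {W : Type} {R : W → W → Prop} {G : Set (Set W)} {X : Set W}
    (hX : genBy R G X) : ∃ n, X ∈ genStage R G n := by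
  induction hX with
  | basic h => exact ⟨0, Or.inl h⟩
  | empty => exact ⟨0, Or.inr (Or.inl rfl)⟩
  | univ => exact ⟨0, Or.inr (Or.inr rfl)⟩
  | inter _ _ ih₁ ih₂ =>
    obtain ⟨m, hm⟩ := ih₁
    obtain ⟨n, hn⟩ := ih₂
    exact ⟨max m n + 1, Or.inl (Or.inl (Or.inr ⟨_, genStage_mono R G (le_max_left m n) hm, _,
      genStage_mono R G (le_max_right m n) hn, rfl⟩))⟩
  | compl _ ih =>
    obtain ⟨n, hn⟩ := ih
    exact ⟨n + 1, Or.inl (Or.inr ⟨_, hn, rfl⟩)⟩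
  | dia _ ih =>
    obtain ⟨n, hn⟩ := ih
    exact ⟨n + 1, Or.inr ⟨_, hn, rfl⟩⟩

theorem genBy_countable {W : Type} (R : W → W → Prop) {G : Set (Set W)} (hG : G.Countable) :
    {X | genBy R G X}.Countable :=
  (Set.countable_iUnion (genStage_countable R hG)).mono fun _ hX =>
    Set.mem_iUnion.2 (genBy.exists_mem_genStage hX)

/-- A rooted finitely generated descriptive frame for `K4.3` has a countable
set of worlds. -/
theorem rooted_finitely_generated_countable (W : Type) (F : KFrame W)
    (hg : F.IsGeneral) (hroot : ∃ r, F.Rooted r) (hfg : F.FinGenerated)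
    (hd : F.Descriptive) (hK : F.IsFrameFor K43) :
    Countable W := by
  obtain ⟨r, hr⟩ := hroot
  obtain ⟨G, hG, hGen⟩ := hfg
  have hP : ∀ {X}, X ∈ F.P → genBy F.R G X := fun {X} hX => by rwa [hGen] at hX
  have hGP : G ⊆ F.P := fun X hX => by rw [hGen]; exact .basic hX
  have htrans : ∀ {u v w}, F.R u v → F.R v w → F.R u w := hd.transitive_of_K43 hg hK
  have hconn : ∀ {u v w}, F.R u v → F.R u w → v = w ∨ F.R v w ∨ F.R w v :=
    hd.connected_of_K43 hg hK
  have hlin : ∀ x y, x = y ∨ F.R x y ∨ F.R y x := by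
    intro x y
    rcases hr x with rfl | hx
    · exact (hr y).imp_right Or.inl
    rcases hr y with rfl | hy
    · exact .inr (.inr hx)
    exact hconn hx hy
  have hY : ∀ x, ∃ Y ∈ F.P, x ∈ Y ∧ (¬ F.R x x → x ∉ F.dia Y) ∧
      ∀ z, F.R x z → z ∈ F.dia Y → KFrame.genType G z ∈ F.clusterTypes G x := by
    intro x
    obtain ⟨Y, hYP, hxY, hY⟩ := hd.exists_neighbourhood hg (x := x)
      (hg.genType_preimage_mem hG hGP (F.clusterTypes G x)ᶜ)
      fun z hxz hzx hz => hz ⟨z, .inr ⟨hxz, hzx⟩, rfl⟩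
    replace hY := fun z h₁ h₂ => not_not.1 (hY z h₁ h₂)
    by_cases hxx : F.R x x
    · exact ⟨Y, hYP, hxY, fun h => absurd hxx h, hY⟩
    · obtain ⟨X, hX, hxX, hX'⟩ := hd.exists_of_not_rel hxx
      exact ⟨X ∩ Y, hg.2.2.2.1 _ hX _ hYP, ⟨hxX, hxY⟩,
        fun _ h => hX' (KFrame.dia_mono Set.inter_subset_left h),
        fun z h₁ h₂ => hY z h₁ (KFrame.dia_mono Set.inter_subset_right h₂)⟩
  choose Y hYP hxY hirr hY using hY
  have : Finite G := hG
  have : Countable F.P := by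
    rw [hGen]
    exact (genBy_countable F.R hG.countable).to_subtype
  let f : W → F.P × Prop × Set G × Set (Set G) := fun x =>
    (⟨Y x, hYP x⟩, F.R x x, KFrame.genType G x, F.clusterTypes G x)
  refine Function.Injective.countable (f := f) ?_
  have key : ∀ x y, f x = f y → F.R x y → x = y := by
    intro x y hf hxy
    simp only [f, Prod.mk.injEq, Subtype.mk.injEq, eq_iff_iff] at hf
    obtain ⟨hYxy, hrefl, ht, hT⟩ := hf
    have hxx : F.R x x := by
      by_contra hxx
      exact hirr x hxx ⟨y, hYxy ▸ hxY y, hxy⟩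
    have hyy := hrefl.1 hxx
    refine hd.1 x y fun X hX => KFrame.mem_iff_mem_of_genType_eq htrans hconn hxy hyy ?_ (hP hX)
      hxx hxy hxy hyy ht
    intro z hxz hzy
    rw [← hT]
    exact hY x z hxz ⟨y, hYxy ▸ hxY y, hzy⟩
  intro x y hf
  rcases hlin x y with h | h | h
  · exact h
  · exact key x y hf h
  · exact (key y x hf.symm h).symm
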